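/- (Lemma E.1 of the paper.) Let (Ω, F, (F_t)_{t∈ℕ}, P) be a filtered probability space, and let (S_t)_{t≥0} and (V_t)_{t≥0} be adapted real-valued processes with S_0 = 0, V_0 = 0 and V_t ≥ 0. Define ψ_e(λ) = −λ − log(1 − λ) for λ ∈ [0, 1). Suppose that for every λ ∈ [0, 1) the process exp(λ S_t − ψ_e(λ) V_t) is a nonnegative supermartingale with initial value 1. Fix τ > 0 and α ∈ (0,1). Define C(τ) = τ^τ e^{−τ} / (Γ(τ) − Γ(τ, τ)), where Γ is the gamma function and Γ(a, x) = ∫_x^∞ u^{a−1} e^{−u} du is the upper incomplete gamma function, and define u(V; τ, α) = sqrt( 2 ((τ + V)/t)/t · log( sqrt((τ + V)/(2π)) · e^{−1/(12(τ+V)+1)} · (1 + α^{−1})/C(τ) ) ) + (1/t) · log( sqrt((τ + V)/(2π)) · e^{−1/(12(τ+V)+1)} · (1 + α^{−1})/C(τ) ). Then P( ∃ t ≥ 1 : S_t/t ≥ max( C(τ)/t , u(V_t; τ, α) ) ) ≤ α. -/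

import Mathlib

open MeasureTheory Real

/-- The upper incomplete gamma function `Γ(a, x) = ∫_x^∞ u^{a-1} e^{-u} du`. -/
noncomputable def upperIncompleteGamma (a x : ℝ) : ℝ :=
  ∫ u in Set.Ioi x, u ^ (a - 1) * Real.exp (-u)

/-- `C(τ) = τ^τ e^{-τ} / (Γ(τ) - Γ(τ, τ))`. -/
noncomputable def Cconst (τ : ℝ) : ℝ :=
  τ ^ τ * Real.exp (-τ) / (Real.Gamma τ - upperIncompleteGamma τ τ)

/-- The curved boundary
`u(V; τ, α) = √(2 ((τ+V)/t)/t · log(√((τ+V)/(2π)) e^{-1/(12(τ+V)+1)} (1+α⁻¹)/C(τ)))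
  + (1/t) log(√((τ+V)/(2π)) e^{-1/(12(τ+V)+1)} (1+α⁻¹)/C(τ))`. -/
noncomputable def curvedBoundary (τ α : ℝ) (t : ℕ) (V : ℝ) : ℝ :=
  Real.sqrt (2 * (((τ + V) / (t : ℝ)) / (t : ℝ)) *
      Real.log (Real.sqrt ((τ + V) / (2 * π)) * Real.exp (-1 / (12 * (τ + V) + 1)) *
        (1 + α⁻¹) / Cconst τ)) +
    (1 / (t : ℝ)) *
      Real.log (Real.sqrt ((τ + V) / (2 * π)) * Real.exp (-1 / (12 * (τ + V) + 1)) *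
        (1 + α⁻¹) / Cconst τ)


lemma stirling_step (p : ℝ) (hp : 0 < p) :
    1 + (1 / (12 * p + 1) - 1 / (12 * (p + 1) + 1)) ≤
      (p + 1 / 2) * (Real.log (p + 1) - Real.log p) := by
  set φ : ℝ → ℝ := fun p => Real.log (p + 1) - Real.log p -
    (1 + (1 / (12 * p + 1) - 1 / (12 * (p + 1) + 1))) / (p + 1 / 2) with hφ
  have hder : ∀ x : ℝ, 0 < x → HasDerivAt φ (1 / (x + 1) - 1 / x -
      (((-12 / (12 * x + 1) ^ 2 + 12 / (12 * (x + 1) + 1) ^ 2)) * (x + 1 / 2) -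
        (1 + (1 / (12 * x + 1) - 1 / (12 * (x + 1) + 1))) * 1) / (x + 1 / 2) ^ 2) x := by
    intro x hx
    have h1 : HasDerivAt (fun p : ℝ => Real.log (p + 1)) (1 / (x + 1)) x :=
      ((hasDerivAt_id x).add_const 1).log (by simp; positivity)
    have h2 : HasDerivAt (fun p : ℝ => Real.log p) (1 / x) x :=
      (hasDerivAt_id x).log (by simp; positivity)
    have h3 : HasDerivAt (fun p : ℝ => 12 * p + 1) 12 x := by
      simpa using ((hasDerivAt_id x).const_mul 12).add_const 1
    have h4 : HasDerivAt (fun p : ℝ => 12 * (p + 1) + 1) 12 x := by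
      simpa using (((hasDerivAt_id x).add_const 1).const_mul 12).add_const 1
    have h5 : HasDerivAt (fun p : ℝ => p + 1 / 2) 1 x := (hasDerivAt_id x).add_const _
    have h6 := (hasDerivAt_const x (1 : ℝ)).div h3 (by positivity)
    have h7 := (hasDerivAt_const x (1 : ℝ)).div h4 (by positivity)
    have h8 := ((h6.sub h7).const_add 1).div h5 (by positivity)
    have h9 := (h1.sub h2).sub h8
    refine h9.congr_deriv ?_
    simp only [Pi.sub_apply, Pi.div_apply]
    ring
  have hanti : AntitoneOn φ (Set.Ioi 0) := by
    apply antitoneOn_of_deriv_nonpos (convex_Ioi 0)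
    · exact fun x hx => (hder x hx).continuousAt.continuousWithinAt
    · rw [interior_Ioi]
      exact fun x hx => (hder x hx).differentiableAt.differentiableWithinAt
    · rw [interior_Ioi]
      intro x hx
      have hx : 0 < x := hx
      rw [(hder x hx).deriv]
      have : 1 / (x + 1) - 1 / x -
      (((-12 / (12 * x + 1) ^ 2 + 12 / (12 * (x + 1) + 1) ^ 2)) * (x + 1 / 2) -
        (1 + (1 / (12 * x + 1) - 1 / (12 * (x + 1) + 1))) * 1) / (x + 1 / 2) ^ 2 =
        - (4608 * (x+1/2)^3 - 2640 * (x+1/2)^2 - 1104 * (x+1/2) + 805) /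
          (4 * x * (x+1) * (x + 1 / 2) ^ 2 * ((12 * x + 1) * (12 * (x + 1) + 1))^2) := by
        field_simp
        ring
      rw [this]
      apply div_nonpos_of_nonpos_of_nonneg
      · nlinarith [mul_nonneg hx.le (sq_nonneg (x - 1/32)), sq_nonneg (x - 1/32), hx]
      · positivity
  have hlim : Filter.Tendsto (fun n : ℕ => φ (n : ℝ)) Filter.atTop (nhds 0) := by
    have e1 : Filter.Tendsto (fun n : ℕ => Real.log ((n : ℝ) + 1) - Real.log n)
        Filter.atTop (nhds 0) := Real.tendsto_log_nat_add_one_sub_log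
    have hn : Filter.Tendsto (fun n : ℕ => (n : ℝ)) Filter.atTop Filter.atTop :=
      tendsto_natCast_atTop_atTop
    have a1 : Filter.Tendsto (fun n : ℕ => 12 * (n : ℝ) + 1) Filter.atTop Filter.atTop :=
      Filter.tendsto_atTop_add_const_right _ _ (hn.const_mul_atTop (by norm_num))
    have a2 : Filter.Tendsto (fun n : ℕ => 12 * ((n : ℝ) + 1) + 1) Filter.atTop Filter.atTop :=
      Filter.tendsto_atTop_add_const_right _ _
        ((Filter.tendsto_atTop_add_const_right _ _ hn).const_mul_atTop (by norm_num))
    have a3 : Filter.Tendsto (fun n : ℕ => (n : ℝ) + 1 / 2) Filter.atTop Filter.atTop :=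
      Filter.tendsto_atTop_add_const_right _ _ hn
    have b := (((a1.const_div_atTop 1).sub (a2.const_div_atTop 1)).const_add 1).div_atTop a3
    simpa [hφ] using e1.sub b
  have hnn : 0 ≤ φ p := by
    refine le_of_tendsto hlim ?_
    filter_upwards [Filter.eventually_ge_atTop ⌈p⌉₊] with n hn
    have : p ≤ n := Nat.ceil_le.mp hn
    exact hanti hp (lt_of_lt_of_le hp this) this
  simp only [hφ, sub_nonneg] at hnn
  rw [div_le_iff₀ (by positivity)] at hnn
  linarith

lemma log_Gamma_add_nat (x : ℝ) (hx : 0 < x) (n : ℕ) :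
    Real.log (Real.Gamma (x + n)) =
      Real.log (Real.Gamma x) + ∑ m ∈ Finset.range n, Real.log (x + m) := by
  induction n with
  | zero => simp
  | succ n ih =>
    rw [Finset.sum_range_succ, ← add_assoc, ← ih]
    push_cast
    rw [← add_assoc, Real.Gamma_add_one (by positivity),
      Real.log_mul (by positivity) (Real.Gamma_pos_of_pos (by positivity)).ne']
    ring

lemma stirling_gamma_lower (k : ℝ) (hk : 0 < k) :
    (k - 1 / 2) * Real.log k - k + Real.log (2 * π) / 2 + 1 / (12 * k + 1) ≤
      Real.log (Real.Gamma k) := by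
  set F : ℝ → ℝ := fun x => Real.log (Real.Gamma x) -
    ((x - 1 / 2) * Real.log x - x + Real.log (2 * π) / 2 + 1 / (12 * x + 1)) with hF
  have hstep : ∀ x, 0 < x → F (x + 1) ≤ F x := by
    intro x hx
    have := stirling_step x hx
    simp only [hF]
    rw [Real.Gamma_add_one hx.ne', Real.log_mul hx.ne' (Real.Gamma_pos_of_pos hx).ne']
    nlinarith
  have hn : ∀ n : ℕ, F (k + n) ≤ F k := by
    intro n
    induction n with
    | zero => simp
    | succ n ih =>
      refine le_trans ?_ ih
      have := hstep (k + n) (by positivity)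
      push_cast
      rwa [← add_assoc]
  have hlim : Filter.Tendsto (fun n : ℕ => F (k + (n + 1 : ℕ))) Filter.atTop (nhds 0) := by
    have t1 : Filter.Tendsto (fun n => Real.BohrMollerup.logGammaSeq k n) Filter.atTop
        (nhds (Real.log (Real.Gamma k))) := by
      have := Real.BohrMollerup.tendsto_logGammaSeq (f := Real.log ∘ Real.Gamma)
        Real.convexOn_log_Gamma (fun {y} hy => ?_) hk
      · simpa using this
      simp only [Function.comp]
      rw [Real.Gamma_add_one hy.ne', Real.log_mul hy.ne' (Real.Gamma_pos_of_pos hy).ne']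
      ring
    have t2 : Filter.Tendsto (fun n => Real.log (Stirling.stirlingSeq n)) Filter.atTop
        (nhds (Real.log (√π))) :=
      Stirling.tendsto_stirlingSeq_sqrt_pi.log (by positivity)
    have hnT : Filter.Tendsto (fun n : ℕ => (n : ℝ)) Filter.atTop Filter.atTop :=
      tendsto_natCast_atTop_atTop
    have t3 : Filter.Tendsto (fun n : ℕ => (n : ℝ) * Real.log (1 + (k + 1) / n)) Filter.atTop
        (nhds (k + 1)) :=
      (Real.tendsto_mul_log_one_add_div_atTop (k + 1)).comp hnT
    have t4 : Filter.Tendsto (fun n : ℕ => Real.log (1 + (k + 1) / n)) Filter.atTop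
        (nhds 0) := by
      have := ((hnT.const_div_atTop (k + 1)).const_add 1).log (by norm_num)
      simpa using this
    have t5 : Filter.Tendsto (fun n : ℕ => 1 / (12 * (k + (n + 1 : ℕ)) + 1)) Filter.atTop
        (nhds 0) := by
      apply Filter.Tendsto.const_div_atTop
      apply Filter.tendsto_atTop_add_const_right
      apply Filter.Tendsto.const_mul_atTop (by norm_num)
      apply Filter.tendsto_atTop_add_const_left
      exact hnT.comp (Filter.tendsto_add_atTop_nat 1)
    have T := (((((t1.const_sub (Real.log (Real.Gamma k))).add t2).sub t3).sub
      (t4.const_mul (k + 1 / 2))).sub t5).add_const (k + 1 + Real.log 2 / 2 - Real.log (2 * π) / 2)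
    have e0 : Real.log (Real.Gamma k) - Real.log (Real.Gamma k) + Real.log √π - (k + 1) -
        (k + 1 / 2) * 0 - 0 + (k + 1 + Real.log 2 / 2 - Real.log (2 * π) / 2) = 0 := by
      rw [Real.log_sqrt pi_pos.le, Real.log_mul (by norm_num) pi_pos.ne']
      ring
    rw [e0] at T
    refine T.congr' ?_
    filter_upwards [Filter.eventually_ge_atTop 1] with n hn1
    have hn0 : (0 : ℝ) < n := by exact_mod_cast hn1
    simp only [hF]
    rw [log_Gamma_add_nat k hk (n + 1), Stirling.log_stirlingSeq_formula,
      Real.BohrMollerup.logGammaSeq]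
    have e1 : Real.log (1 + (k + 1) / n) = Real.log (k + (n + 1 : ℕ)) - Real.log n := by
      rw [← Real.log_div (by positivity) hn0.ne']
      congr 1
      push_cast
      field_simp
      ring
    rw [e1, Real.log_mul (by norm_num) hn0.ne', Real.log_div hn0.ne' (by positivity), Real.log_exp]
    push_cast
    ring
  have : 0 ≤ F k := le_of_tendsto' hlim (fun n => hn _)
  simp only [hF] at this
  linarith

lemma gammaInt_on (k : ℝ) (hk : 0 < k) :
    IntegrableOn (fun u : ℝ => u ^ (k - 1) * Real.exp (-u)) (Set.Ioi 0) :=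
  (Real.GammaIntegral_convergent hk).congr_fun (fun _ _ => mul_comm _ _) measurableSet_Ioi

lemma upper_gamma_bound (k r : ℝ) (hk : 0 < k) (hr : k < r) :
    (r - k) * upperIncompleteGamma k r ≤ r ^ k * Real.exp (-r) := by
  have hr0 : 0 < r := hk.trans hr
  have i1 : IntegrableOn (fun u : ℝ => u ^ (k - 1) * Real.exp (-u)) (Set.Ioi r) :=
    (gammaInt_on k hk).mono_set (Set.Ioi_subset_Ioi hr0.le)
  have i2 : IntegrableOn (fun u : ℝ => u ^ (k + 1 - 1) * Real.exp (-u)) (Set.Ioi r) :=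
    (gammaInt_on (k + 1) (by positivity)).mono_set (Set.Ioi_subset_Ioi hr0.le)
  have i3 : IntegrableOn (fun u : ℝ => (u - k) * (u ^ (k - 1) * Real.exp (-u))) (Set.Ioi r) := by
    refine (i2.sub (i1.const_mul k)).congr_fun (fun u hu => ?_) measurableSet_Ioi
    have hu : 0 < u := hr0.trans hu
    have : u ^ (k + 1 - 1) = u * u ^ (k - 1) := by
      rw [← Real.rpow_one_add' hu.le (by ring_nf; exact hk.ne')]; congr 1; ring
    simp only [Pi.sub_apply, this]
    ring
  have hFTC : ∫ u in Set.Ioi r, (u - k) * (u ^ (k - 1) * Real.exp (-u)) =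
      0 - (-(r ^ k * Real.exp (-r))) := by
    refine integral_Ioi_of_hasDerivAt_of_tendsto' (f := fun u => -(u ^ k * Real.exp (-u)))
      (fun u hu => ?_) i3 ?_
    · have hu : 0 < u := lt_of_lt_of_le hr0 hu
      have h1 : HasDerivAt (fun u : ℝ => u ^ k) (k * u ^ (k - 1)) u :=
        Real.hasDerivAt_rpow_const (Or.inl hu.ne')
      have h2 : HasDerivAt (fun u : ℝ => Real.exp (-u)) (Real.exp (-u) * (-1)) u :=
        (hasDerivAt_neg u).exp
      refine (h1.mul h2).neg.congr_deriv ?_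
      have : u ^ k = u * u ^ (k - 1) := by
        rw [← Real.rpow_one_add' hu.le (by ring_nf; exact hk.ne')]; congr 1; ring
      rw [this]; ring
    · have := (tendsto_rpow_mul_exp_neg_mul_atTop_nhds_zero k 1 one_pos).neg
      simpa using this
  have : (r - k) * upperIncompleteGamma k r ≤
      ∫ u in Set.Ioi r, (u - k) * (u ^ (k - 1) * Real.exp (-u)) := by
    rw [upperIncompleteGamma, ← integral_const_mul]
    refine setIntegral_mono_on (i1.const_mul _) i3 measurableSet_Ioi (fun u hu => ?_)
    have hu' : r < u := hu
    have : 0 < u := hr0.trans hu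
    gcongr
  rw [hFTC] at this
  linarith

lemma scaled_int_on (k r : ℝ) (hk : 0 < k) (hr : 0 < r) :
    IntegrableOn (fun x : ℝ => x ^ (k - 1) * Real.exp (-(r * x))) (Set.Ioi 0) := by
  refine (integrableOn_rpow_mul_exp_neg_mul_rpow (s := k - 1) (p := 1) (b := r)
    (by linarith) one_pos hr).congr_fun (fun x _ => ?_) measurableSet_Ioi
  simp

lemma lower_gamma_scaled (k r : ℝ) (hk : 0 < k) (hr : 0 < r) :
    ∫ x in Set.Ioc (0 : ℝ) 1, x ^ (k - 1) * Real.exp (-(r * x)) =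
      (r ^ k)⁻¹ * (Real.Gamma k - upperIncompleteGamma k r) := by
  have h1 := Real.integral_rpow_mul_exp_neg_mul_Ioi hk hr
  have hi := scaled_int_on k r hk hr
  have h2 : ∫ x in Set.Ioi (1 : ℝ), x ^ (k - 1) * Real.exp (-(r * x)) =
      (r ^ k)⁻¹ * upperIncompleteGamma k r := by
    have h := integral_comp_mul_left_Ioi (fun u : ℝ => u ^ (k - 1) * Real.exp (-u)) 1 hr
    rw [mul_one] at h
    have e : ∫ x in Set.Ioi (1 : ℝ), (r * x) ^ (k - 1) * Real.exp (-(r * x)) =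
        r ^ (k - 1) * ∫ x in Set.Ioi (1 : ℝ), x ^ (k - 1) * Real.exp (-(r * x)) := by
      rw [← integral_const_mul]
      refine setIntegral_congr_fun measurableSet_Ioi (fun x hx => ?_)
      have hx : 0 < x := lt_trans one_pos hx
      rw [Real.mul_rpow hr.le hx.le]; ring
    rw [e, smul_eq_mul] at h
    have hrk : r ^ k = r ^ (k - 1) * r := by
      rw [Real.rpow_sub_one hr.ne']; field_simp
    have hp : 0 < r ^ (k - 1) := by positivity
    rw [hrk, upperIncompleteGamma]
    field_simp
    field_simp at h
    linarith
  have h3 : Set.Ioi (0 : ℝ) = Set.Ioc 0 1 ∪ Set.Ioi 1 := by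
    rw [Set.Ioc_union_Ioi_eq_Ioi zero_le_one]
  rw [h3, setIntegral_union (Set.Ioc_disjoint_Ioi le_rfl) measurableSet_Ioi
    (hi.mono_set Set.Ioc_subset_Ioi_self) (hi.mono_set (Set.Ioi_subset_Ioi zero_le_one)), h2] at h1
  rw [one_div, Real.inv_rpow hr.le] at h1
  linarith

lemma lower_gamma_pos (k r : ℝ) (hk : 0 < k) (hr : 0 < r) :
    0 < Real.Gamma k - upperIncompleteGamma k r := by
  have h := lower_gamma_scaled k r hk hr
  have hpos : 0 < ∫ x in Set.Ioc (0 : ℝ) 1, x ^ (k - 1) * Real.exp (-(r * x)) := by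
    rw [setIntegral_pos_iff_support_of_nonneg_ae]
    · have : Set.Ioc (0:ℝ) 1 ⊆
        Function.support (fun x : ℝ => x ^ (k - 1) * Real.exp (-(r * x))) := by
        intro x hx
        have : 0 < x := hx.1
        simp only [Function.mem_support]; positivity
      rw [Set.inter_eq_self_of_subset_right this]
      simp
    · filter_upwards [self_mem_ae_restrict measurableSet_Ioc] with x hx
      have : 0 < x := hx.1
      simp only [Pi.zero_apply]; positivity
    · exact (scaled_int_on k r hk hr).mono_set Set.Ioc_subset_Ioi_self
  rw [h] at hpos
  exact pos_of_mul_pos_right hpos (by positivity)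

lemma Cconst_pos (τ : ℝ) (hτ : 0 < τ) : 0 < Cconst τ := by
  have := lower_gamma_pos τ τ hτ hτ
  unfold Cconst; positivity

lemma scalar_bound (τ α k s : ℝ) (hτ : 0 < τ) (hα : 0 < α) (hk : 0 < k)
    (hsC : Cconst τ ≤ s)
    (hs : √(2 * k * Real.log (√(k / (2 * π)) * Real.exp (-1 / (12 * k + 1)) *
        (1 + α⁻¹) / Cconst τ)) + Real.log (√(k / (2 * π)) * Real.exp (-1 / (12 * k + 1)) *
        (1 + α⁻¹) / Cconst τ) ≤ s) :
    α⁻¹ ≤ Cconst τ * Real.exp (s + k) *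
      (((s + k) ^ k)⁻¹ * (Real.Gamma k - upperIncompleteGamma k (s + k))) := by
  have hC := Cconst_pos τ hτ
  set C := Cconst τ
  have hs0 : 0 < s := lt_of_lt_of_le hC hsC
  have hL : Real.log (√(k / (2 * π)) * Real.exp (-1 / (12 * k + 1)) * (1 + α⁻¹) / C) =
      (Real.log k - Real.log (2 * π)) / 2 - 1 / (12 * k + 1) + Real.log (1 + α⁻¹) - Real.log C := by
    rw [Real.log_div (by positivity) hC.ne', Real.log_mul (by positivity) (by positivity),
      Real.log_mul (by positivity) (by positivity), Real.log_exp, Real.log_sqrt (by positivity),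
      Real.log_div hk.ne' (by positivity)]
    ring
  rw [hL] at hs
  set L := (Real.log k - Real.log (2 * π)) / 2 - 1 / (12 * k + 1) + Real.log (1 + α⁻¹) - Real.log C
    with hLdef
  -- the deterministic inequality
  have hdet : L ≤ s - k * (Real.log (s + k) - Real.log k) := by
    have hlog : Real.log (s + k) - Real.log k = Real.log (1 + s / k) := by
      rw [← Real.log_div (by positivity) hk.ne']; congr 1; field_simp; ring
    rw [hlog]
    rcases le_total L 0 with h0 | h0
    · have := Real.log_le_sub_one_of_pos (show 0 < 1 + s / k by positivity)
      have h2 : k * Real.log (1 + s / k) ≤ k * (s / k) := by gcongr; linarith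
      rw [mul_div_cancel₀ _ hk.ne'] at h2
      linarith
    · -- concavity: compare with the point x = q + q^2/2
      set q := √(2 * L / k) with hq
      have hq2 : q ^ 2 = 2 * L / k := Real.sq_sqrt (by positivity)
      have hq0 : 0 ≤ q := Real.sqrt_nonneg _
      have hsq : √(2 * k * L) = k * q := by
        rw [Real.sqrt_eq_iff_mul_self_eq (by positivity) (by positivity)]
        have : k * q * (k * q) = k ^ 2 * q ^ 2 := by ring
        rw [this, hq2]; field_simp
      have hLq : L = k * (q ^ 2 / 2) := by rw [hq2]; field_simp
      rw [hsq] at hs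
      have hx : q + q ^ 2 / 2 ≤ s / k := by
        rw [le_div_iff₀ hk]; linarith
      have hexp := Real.quadratic_le_exp_of_nonneg hq0
      have hle : Real.log (1 + s / k) ≤ q + (s / k - (q + q ^ 2 / 2)) := by
        rw [Real.log_le_iff_le_exp (by positivity), Real.exp_add]
        have h1 := Real.add_one_le_exp (s / k - (q + q ^ 2 / 2))
        have h2 : 1 ≤ Real.exp q := Real.one_le_exp hq0
        nlinarith [sub_nonneg.2 hx]
      have h2 : k * Real.log (1 + s / k) ≤ k * (q + (s / k - (q + q ^ 2 / 2))) := by gcongr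
      have h3 : k * (q + (s / k - (q + q ^ 2 / 2))) = s - k * (q ^ 2 / 2) := by field_simp; ring
      linarith
  have hst := stirling_gamma_lower k hk
  have hG : 1 + α⁻¹ ≤ C * Real.exp (s + k) * (((s + k) ^ k)⁻¹ * Real.Gamma k) := by
    have hGp := Real.Gamma_pos_of_pos hk
    rw [← Real.log_le_log_iff (by positivity) (by positivity),
      Real.log_mul (by positivity) (by positivity), Real.log_mul (by positivity) (by positivity),
      Real.log_mul (by positivity) (by positivity), Real.log_exp, Real.log_inv,
      Real.log_rpow (by positivity)]
    nlinarith
  have hU := upper_gamma_bound k (s + k) hk (by linarith)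
  have hU2 : C * Real.exp (s + k) * (((s + k) ^ k)⁻¹ * upperIncompleteGamma k (s + k)) ≤ 1 := by
    have hP : 0 < (s + k) ^ k := by positivity
    have hu : upperIncompleteGamma k (s + k) ≤ (s + k) ^ k * Real.exp (-(s + k)) / s := by
      rw [le_div_iff₀ hs0]; ring_nf at hU ⊢; linarith
    calc _ ≤ C * Real.exp (s + k) * (((s + k) ^ k)⁻¹ *
          ((s + k) ^ k * Real.exp (-(s + k)) / s)) := by gcongr
      _ = C / s := by rw [Real.exp_neg]; field_simp
      _ ≤ 1 := by rw [div_le_one hs0]; exact hsC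
  rw [mul_sub, mul_sub]
  linarith

lemma ville_disjointed {Ω : Type*} {m0 : MeasurableSpace Ω} (μ : Measure Ω)
    [IsProbabilityMeasure μ] (ℱ : Filtration ℕ m0) (X : ℕ → Ω → ℝ)
    (hX : Supermartingale X ℱ μ) (A : ℕ → Set Ω)
    (hA : ∀ t, MeasurableSet[ℱ t] (A t)) (n : ℕ) :
    ∑ t ∈ Finset.range (n + 1), ∫ ω in disjointed A t, X t ω ∂μ +
      ∫ ω in (partialSups A n)ᶜ, X n ω ∂μ ≤ ∫ ω, X 0 ω ∂μ := by
  have hP : ∀ t, MeasurableSet[ℱ t] (partialSups A t) := by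
    intro t
    induction t with
    | zero => simpa using hA 0
    | succ t ih =>
      rw [partialSups_add_one]
      exact MeasurableSet.union (ℱ.mono (Nat.le_succ t) _ ih) (hA (t + 1))
  induction n with
  | zero =>
    simp only [zero_add, Finset.range_one, Finset.sum_singleton, disjointed_zero, partialSups_zero]
    exact (integral_add_compl (ℱ.le 0 _ (hA 0)) (hX.integrable 0)).le
  | succ n ih =>
    refine le_trans ?_ ih
    rw [Finset.sum_range_succ, add_assoc]
    gcongr
    refine le_trans (le_of_eq ?_) (hX.setIntegral_le (Nat.le_succ n) (hP n).compl)
    have hset : (partialSups A n)ᶜ = disjointed A (n + 1) ∪ (partialSups A (n + 1))ᶜ := by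
      rw [disjointed_add_one, partialSups_add_one]
      ext ω
      simp only [Set.mem_compl_iff, Set.mem_union, Set.mem_sdiff, Set.sup_eq_union]
      tauto
    rw [hset, setIntegral_union]
    · rw [disjointed_add_one, partialSups_add_one, Set.disjoint_left]
      intro ω h1 h2
      exact h2 (Or.inr h1.1)
    · exact (ℱ.le _ _ (hP (n + 1))).compl
    · exact (hX.integrable _).integrableOn
    · exact (hX.integrable _).integrableOn

lemma ville_lintegral {Ω : Type*} {m0 : MeasurableSpace Ω} (μ : Measure Ω)
    [IsProbabilityMeasure μ] (ℱ : Filtration ℕ m0) (X : ℕ → Ω → ℝ)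
    (hX : Supermartingale X ℱ μ) (hpos : ∀ t ω, 0 ≤ X t ω) (h0 : ∀ ω, X 0 ω = 1) (A : ℕ → Set Ω)
    (hA : ∀ t, MeasurableSet[ℱ t] (A t)) (n : ℕ) :
    ∑ t ∈ Finset.range (n + 1), ∫⁻ ω in disjointed A t, ENNReal.ofReal (X t ω) ∂μ ≤ 1 := by
  have h := ville_disjointed μ ℱ X hX A hA n
  have h1 : ∫ ω, X 0 ω ∂μ = 1 := by simp [h0]
  have h2 : 0 ≤ ∫ ω in (partialSups A n)ᶜ, X n ω ∂μ := integral_nonneg (hpos n)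
  have h3 : ∑ t ∈ Finset.range (n + 1), ∫ ω in disjointed A t, X t ω ∂μ ≤ 1 := by linarith
  have h4 : ∀ t, ∫⁻ ω in disjointed A t, ENNReal.ofReal (X t ω) ∂μ =
      ENNReal.ofReal (∫ ω in disjointed A t, X t ω ∂μ) := fun t =>
    (ofReal_integral_eq_lintegral_ofReal (hX.integrable t).integrableOn
      (Filter.Eventually.of_forall (hpos t))).symm
  simp_rw [h4]
  rw [← ENNReal.ofReal_sum_of_nonneg (fun t _ => integral_nonneg (hpos t))]
  exact ENNReal.ofReal_le_one.2 h3

lemma mixture_ville {Ω : Type*} {m0 : MeasurableSpace Ω} (μ : Measure Ω)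
    [IsProbabilityMeasure μ] (ℱ : Filtration ℕ m0) (X : ℝ → ℕ → Ω → ℝ) (ν : Measure ℝ)
    [SFinite ν] (w : ℝ → ENNReal) (hw : Measurable w) (hw1 : ∫⁻ x, w x ∂ν ≤ 1)
    (hXm : ∀ t, Measurable (fun p : ℝ × Ω => X p.1 t p.2))
    (hX : ∀ᵐ x ∂ν, Supermartingale (X x) ℱ μ ∧ (∀ t ω, 0 ≤ X x t ω) ∧ ∀ ω, X x 0 ω = 1)
    (A : ℕ → Set Ω) (hA : ∀ t, MeasurableSet[ℱ t] (A t)) (α : ℝ) (hα : 0 < α)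
    (hbig : ∀ t, ∀ ω ∈ A t, ENNReal.ofReal α⁻¹ ≤ ∫⁻ x, w x * ENNReal.ofReal (X x t ω) ∂ν) :
    μ (⋃ t, A t) ≤ ENNReal.ofReal α := by
  have hAm : ∀ t, MeasurableSet (A t) := fun t => ℱ.le t _ (hA t)
  have hDm : ∀ t, MeasurableSet (disjointed A t) := fun t => MeasurableSet.disjointed hAm t
  rw [← iUnion_disjointed, measure_iUnion (disjoint_disjointed A) hDm]
  refine ENNReal.tsum_le_of_sum_range_le fun n => ?_
  refine le_trans (Finset.sum_le_sum_of_subset (Finset.range_mono (Nat.le_succ n))) ?_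
  have key : ENNReal.ofReal α⁻¹ * ∑ t ∈ Finset.range (n + 1), μ (disjointed A t) ≤ 1 := by
    calc ENNReal.ofReal α⁻¹ * ∑ t ∈ Finset.range (n + 1), μ (disjointed A t)
        = ∑ t ∈ Finset.range (n + 1), ∫⁻ _ in disjointed A t, ENNReal.ofReal α⁻¹ ∂μ := by
          simp [Finset.mul_sum]
      _ ≤ ∑ t ∈ Finset.range (n + 1), ∫⁻ ω in disjointed A t,
            ∫⁻ x, w x * ENNReal.ofReal (X x t ω) ∂ν ∂μ := by
          refine Finset.sum_le_sum fun t _ => setLIntegral_mono' (hDm t) fun ω hω => ?_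
          exact hbig t ω (disjointed_subset A t hω)
      _ = ∑ t ∈ Finset.range (n + 1), ∫⁻ x, w x * ∫⁻ ω in disjointed A t,
            ENNReal.ofReal (X x t ω) ∂μ ∂ν := by
          refine Finset.sum_congr rfl fun t _ => ?_
          rw [lintegral_lintegral_swap]
          · refine lintegral_congr fun x => ?_
            rw [lintegral_const_mul]
            exact ((hXm t).comp measurable_prodMk_left).ennreal_ofReal
          · exact ((hw.comp measurable_snd).mul
              ((hXm t).comp measurable_swap).ennreal_ofReal).aemeasurable
      _ = ∫⁻ x, w x * ∑ t ∈ Finset.range (n + 1), ∫⁻ ω in disjointed A t,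
            ENNReal.ofReal (X x t ω) ∂μ ∂ν := by
          simp_rw [Finset.mul_sum]
          rw [lintegral_finsetSum]
          intro t _
          exact hw.mul (hXm t).ennreal_ofReal.lintegral_prod_right'
      _ ≤ ∫⁻ x, w x * 1 ∂ν := by
          refine lintegral_mono_ae ?_
          filter_upwards [hX] with x hx
          gcongr
          exact ville_lintegral μ ℱ (X x) hx.1 hx.2.1 hx.2.2 A hA n
      _ ≤ 1 := by simpa using hw1
  rw [ENNReal.ofReal_inv_of_pos hα, mul_comm, ← div_eq_mul_inv] at key
  rwa [ENNReal.div_le_iff (by simpa using hα) ENNReal.ofReal_ne_top, one_mul] at key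

/-- Lemma E.1 of the paper.  If `(S, V)` is sub-exponential, i.e. for
every `lam ∈ [0, 1)` the process `exp (lam S_t - ψ_e(lam) V_t)` with
`ψ_e(lam) = -lam - log (1 - lam)` is a nonnegative supermartingale with initial value `1`
(here `S 0 = 0`, `V 0 = 0`, `V ≥ 0`), then for any `τ > 0` and `α ∈ (0,1)`,
`P(∃ t ≥ 1, S_t / t ≥ max (C(τ)/t) (u(V_t; τ, α))) ≤ α`. -/
theorem curved_crossing_boundary {Ω : Type*} {m0 : MeasurableSpace Ω} (μ : Measure Ω)
    [IsProbabilityMeasure μ] (ℱ : Filtration ℕ m0)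
    (S V : ℕ → Ω → ℝ) (hS : Adapted ℱ S) (hV : Adapted ℱ V)
    (hS0 : ∀ ω, S 0 ω = 0) (hV0 : ∀ ω, V 0 ω = 0) (hVpos : ∀ t ω, 0 ≤ V t ω)
    (hsub : ∀ lam ∈ Set.Ico (0 : ℝ) 1,
      Supermartingale
        (fun t ω => Real.exp (lam * S t ω - (-lam - Real.log (1 - lam)) * V t ω)) ℱ μ)
    (τ : ℝ) (hτ : 0 < τ) (α : ℝ) (hα : α ∈ Set.Ioo (0 : ℝ) 1) :
    μ {ω | ∃ t : ℕ, 1 ≤ t ∧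
        max (Cconst τ / (t : ℝ)) (curvedBoundary τ α t (V t ω)) ≤ S t ω / (t : ℝ)} ≤
      ENNReal.ofReal α := by
  have hC := Cconst_pos τ hτ
  have hα0 := hα.1
  set A : ℕ → Set Ω := fun t => {ω | 1 ≤ t ∧
    max (Cconst τ / (t : ℝ)) (curvedBoundary τ α t (V t ω)) ≤ S t ω / (t : ℝ)} with hAdef
  have hAset : {ω | ∃ t : ℕ, 1 ≤ t ∧
      max (Cconst τ / (t : ℝ)) (curvedBoundary τ α t (V t ω)) ≤ S t ω / (t : ℝ)} = ⋃ t, A t := by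
    ext ω; simp [hAdef]
  rw [hAset]
  refine mixture_ville μ ℱ
    (fun x t ω => Real.exp ((1 - x) * S t ω - (-(1 - x) - Real.log (1 - (1 - x))) * V t ω))
    (volume.restrict (Set.Ioc (0 : ℝ) 1))
    (fun x => ENNReal.ofReal (Cconst τ * Real.exp τ * (x ^ (τ - 1) * Real.exp (-(τ * x)))))
    (by fun_prop) ?_ ?_ ?_ A ?_ α hα0 ?_
  · -- the mixing density has total mass one
    rw [← ofReal_integral_eq_lintegral_ofReal]
    · rw [integral_const_mul, lower_gamma_scaled τ τ hτ hτ]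
      refine ENNReal.ofReal_le_one.2 (le_of_eq ?_)
      have h1 := lower_gamma_pos τ τ hτ hτ
      rw [Cconst, Real.exp_neg]
      field_simp
    · exact ((scaled_int_on τ τ hτ hτ).mono_set Set.Ioc_subset_Ioi_self).const_mul _
    · filter_upwards [self_mem_ae_restrict measurableSet_Ioc] with x hx
      have : 0 < x := hx.1
      simp only [Pi.zero_apply]; positivity
  · intro t
    have h1 : Measurable (S t) := (hS t).mono (ℱ.le t) le_rfl
    have h2 : Measurable (V t) := (hV t).mono (ℱ.le t) le_rfl
    fun_prop
  · filter_upwards [self_mem_ae_restrict measurableSet_Ioc] with x hx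
    refine ⟨hsub (1 - x) ⟨by linarith [hx.2], by linarith [hx.1]⟩, fun t ω => by positivity,
      fun ω => by simp [hS0, hV0]⟩
  · intro t
    have h1 : Measurable[ℱ t] (S t) := hS t
    have h2 : Measurable[ℱ t] (V t) := hV t
    have hcb : Measurable (curvedBoundary τ α t) := by
      unfold curvedBoundary; fun_prop
    have h3 : Measurable[ℱ t] (fun ω => curvedBoundary τ α t (V t ω)) := hcb.comp h2
    refine MeasurableSet.inter (MeasurableSet.const _) ?_
    exact @measurableSet_le _ _ _ _ _ (ℱ t) _ _ _ _ _ (measurable_const.max h3) (h1.div_const _)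
  · rintro t ω ⟨ht, hmax⟩
    have ht0 : (0 : ℝ) < t := by exact_mod_cast ht
    have hk : 0 < τ + V t ω := by linarith [hVpos t ω]
    rw [max_le_iff] at hmax
    obtain ⟨hm1, hm2⟩ := hmax
    have hsC : Cconst τ ≤ S t ω := by rwa [div_le_div_iff_of_pos_right ht0] at hm1
    have hs0 : 0 < S t ω := lt_of_lt_of_le hC hsC
    have hsb := scalar_bound τ α (τ + V t ω) (S t ω) hτ hα0 hk hsC (by
      rw [le_div_iff₀ ht0, curvedBoundary] at hm2
      refine le_trans (le_of_eq ?_) hm2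
      generalize Real.log (√((τ + V t ω) / (2 * π)) * Real.exp (-1 / (12 * (τ + V t ω) + 1)) *
        (1 + α⁻¹) / Cconst τ) = L
      have e : 2 * ((τ + V t ω) / (t : ℝ) / t) * L = 2 * (τ + V t ω) * L / t ^ 2 := by
        field_simp
      rw [e, Real.sqrt_div' _ (by positivity), Real.sqrt_sq ht0.le]
      field_simp)
    rw [← lower_gamma_scaled _ _ hk (by positivity), ← integral_const_mul] at hsb
    refine le_trans (ENNReal.ofReal_le_ofReal hsb) ?_
    rw [ofReal_integral_eq_lintegral_ofReal]
    · refine le_of_eq (setLIntegral_congr_fun measurableSet_Ioc fun x hx => ?_)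
      have hx0 : 0 < x := hx.1
      rw [← ENNReal.ofReal_mul (by positivity)]
      congr 1
      rw [sub_sub_cancel, Real.rpow_def_of_pos hx0, Real.rpow_def_of_pos hx0]
      simp only [mul_assoc, ← Real.exp_add]
      congr 2
      ring
    · exact ((scaled_int_on _ _ hk (by positivity)).mono_set Set.Ioc_subset_Ioi_self).const_mul _
    · filter_upwards [self_mem_ae_restrict measurableSet_Ioc] with x hx
      have : 0 < x := hx.1
      simp only [Pi.zero_apply]; positivity
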